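/- Under Assumption 1, if p ∈ ℝ^n with p ≥ 0 satisfies p = T(p), then for every x_0 ∈ ℝ^n with x_0 ≥ 0 the optimal value satisfies V(x_0) = p^T x_0; in particular V(x_0) is finite and the infimum over admissible trajectories is attained. -/

import Mathlib

open Matrix Finset

/-- `minZero v` is the minimum of the entries of `v` and of the scalar `0`. -/
noncomputable def minZero {k : ℕ} (v : Fin k → ℝ) : ℝ :=
  (insert (0 : ℝ) (Finset.image v Finset.univ)).min' (Finset.insert_nonempty _ _)

/-- The Bellman operator `T(p) = s + Aᵀ p + Σ_i min{r_i + B_iᵀ p, 0} E_i`. -/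
noncomputable def bellman {n : ℕ} {m : Fin n → ℕ}
    (A : Matrix (Fin n) (Fin n) ℝ) (B : ∀ i, Matrix (Fin n) (Fin (m i)) ℝ)
    (s : Fin n → ℝ) (r : ∀ i, Fin (m i) → ℝ) (E : Matrix (Fin n) (Fin n) ℝ)
    (p : Fin n → ℝ) : Fin n → ℝ :=
  fun j => s j + (Aᵀ *ᵥ p) j +
    ∑ i, minZero (fun l => r i l + ((B i)ᵀ *ᵥ p) l) * E i j

/-- Membership in the set 𝒦 of blockwise nonnegative feedback matrices with
full (`1ᵀ K_i = E_iᵀ`) or zero (`1ᵀ K_i = 0`) actuation in each block. -/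
def memK {n : ℕ} {m : Fin n → ℕ} (E : Matrix (Fin n) (Fin n) ℝ)
    (K : ∀ i, Matrix (Fin (m i)) (Fin n) ℝ) : Prop :=
  ∀ i, (∀ l j, 0 ≤ K i l j) ∧
    ((∀ j, ∑ l, K i l j = E i j) ∨ (∀ j, ∑ l, K i l j = 0))

/-- Assumption 1: `(A + BK) x ≥ 0` for every `K ∈ 𝒦` and every `x ≥ 0`. -/
def assumption1 {n : ℕ} {m : Fin n → ℕ}
    (A : Matrix (Fin n) (Fin n) ℝ) (B : ∀ i, Matrix (Fin n) (Fin (m i)) ℝ)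
    (E : Matrix (Fin n) (Fin n) ℝ) : Prop :=
  ∀ K : ∀ i, Matrix (Fin (m i)) (Fin n) ℝ, memK E K →
    ∀ x : Fin n → ℝ, 0 ≤ x → 0 ≤ (A + ∑ i, B i * K i) *ᵥ x

/-- The constraint set `U(x) = {u : u ≥ 0, 1ᵀ u_i ≤ E_iᵀ x for all i}`. -/
def inputSet {n : ℕ} {m : Fin n → ℕ} (E : Matrix (Fin n) (Fin n) ℝ)
    (x : Fin n → ℝ) : Set (∀ i, Fin (m i) → ℝ) :=
  {u | ∀ i, (∀ l, 0 ≤ u i l) ∧ (∑ l, u i l) ≤ ∑ j, E i j * x j}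

/-- An admissible trajectory from `x0`: `x(0) = x0`, `u(t) ∈ U(x(t))` and
`x(t+1) = A x(t) + B u(t)`. -/
def admissible {n : ℕ} {m : Fin n → ℕ}
    (A : Matrix (Fin n) (Fin n) ℝ) (B : ∀ i, Matrix (Fin n) (Fin (m i)) ℝ)
    (E : Matrix (Fin n) (Fin n) ℝ) (x0 : Fin n → ℝ)
    (x : ℕ → Fin n → ℝ) (u : ℕ → ∀ i, Fin (m i) → ℝ) : Prop :=
  x 0 = x0 ∧ ∀ t, u t ∈ inputSet E (x t) ∧
    x (t + 1) = A *ᵥ x t + ∑ i, (B i) *ᵥ (u t i)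

/-- The state trajectory generated by a control sequence `u` from `x0`. -/
noncomputable def traj {n : ℕ} {m : Fin n → ℕ}
    (A : Matrix (Fin n) (Fin n) ℝ) (B : ∀ i, Matrix (Fin n) (Fin (m i)) ℝ)
    (x0 : Fin n → ℝ) (u : ℕ → ∀ i, Fin (m i) → ℝ) : ℕ → Fin n → ℝ
  | 0 => x0
  | t + 1 => A *ᵥ traj A B x0 u t + ∑ i, (B i) *ᵥ (u t i)

/-- Total cost `Σ_{t=0}^∞ [sᵀ x(t) + rᵀ u(t)] ∈ [0,∞]` of a trajectory. -/
noncomputable def trajCost {n : ℕ} {m : Fin n → ℕ}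
    (s : Fin n → ℝ) (r : ∀ i, Fin (m i) → ℝ)
    (x : ℕ → Fin n → ℝ) (u : ℕ → ∀ i, Fin (m i) → ℝ) : ENNReal :=
  ∑' t, ENNReal.ofReal ((∑ j, s j * x t j) + ∑ i, ∑ l, r i l * u t i l)

/-- Optimal value `V(x0)`: infimum of the total cost over admissible trajectories. -/
noncomputable def optValue {n : ℕ} {m : Fin n → ℕ}
    (A : Matrix (Fin n) (Fin n) ℝ) (B : ∀ i, Matrix (Fin n) (Fin (m i)) ℝ)
    (E : Matrix (Fin n) (Fin n) ℝ) (s : Fin n → ℝ) (r : ∀ i, Fin (m i) → ℝ)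
    (x0 : Fin n → ℝ) : ENNReal :=
  ⨅ (x : ℕ → Fin n → ℝ) (u : ℕ → ∀ i, Fin (m i) → ℝ)
    (_ : admissible A B E x0 x u), trajCost s r x u

/-- The spectral radius of `M` is strictly less than `1`. -/
def schurStable {n : ℕ} (M : Matrix (Fin n) (Fin n) ℝ) : Prop :=
  ∀ μ ∈ spectrum ℂ (M.map Complex.ofReal), ‖μ‖ < 1

open Filter Topology

lemma minZero_le_zero {k : ℕ} (v : Fin k → ℝ) : minZero v ≤ 0 :=
  Finset.min'_le _ _ (Finset.mem_insert_self _ _)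

lemma minZero_le_apply {k : ℕ} (v : Fin k → ℝ) (l : Fin k) : minZero v ≤ v l :=
  Finset.min'_le _ _
    (Finset.mem_insert_of_mem (Finset.mem_image_of_mem v (Finset.mem_univ l)))

/-- `minZero v` times `c` bounds `v ⬝ᵥ u` from below on the simplex `u ≥ 0`, `1ᵀ u ≤ c`. -/
lemma minZero_mul_le_dotProduct {k : ℕ} (v u : Fin k → ℝ) {c : ℝ} (hu : ∀ l, 0 ≤ u l)
    (hc : ∑ l, u l ≤ c) : minZero v * c ≤ v ⬝ᵥ u :=
  calc minZero v * c ≤ minZero v * ∑ l, u l :=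
        mul_le_mul_of_nonpos_left hc (minZero_le_zero v)
    _ = ∑ l, minZero v * u l := Finset.mul_sum _ _ _
    _ ≤ v ⬝ᵥ u :=
        Finset.sum_le_sum fun l _ => mul_le_mul_of_nonneg_right (minZero_le_apply v l) (hu l)

/-- The value `minZero v` is attained at zero or at a vertex of the standard simplex. -/
lemma exists_dotProduct_eq_minZero {k : ℕ} (v : Fin k → ℝ) :
    ∃ w : Fin k → ℝ, (∀ l, 0 ≤ w l) ∧ (∑ l, w l = 1 ∨ ∑ l, w l = 0) ∧
      v ⬝ᵥ w = minZero v := by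
  have hmem : minZero v ∈ insert (0 : ℝ) (Finset.image v Finset.univ) := Finset.min'_mem _ _
  rcases Finset.mem_insert.mp hmem with h | h
  · exact ⟨0, fun _ => le_rfl, Or.inr (by simp), by simp [h]⟩
  · obtain ⟨l, -, hl⟩ := Finset.mem_image.mp h
    refine ⟨Pi.single l 1, fun j => ?_, Or.inl (by simp), by simp [hl]⟩
    by_cases hj : j = l
    · subst hj; simp
    · simp [hj]

section Feedback

variable {n : ℕ} {m : Fin n → ℕ} {A : Matrix (Fin n) (Fin n) ℝ}
  {B : ∀ i, Matrix (Fin n) (Fin (m i)) ℝ} {s : Fin n → ℝ} {r : ∀ i, Fin (m i) → ℝ}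
  {E : Matrix (Fin n) (Fin n) ℝ}

lemma memK_vecMulVec (hE : ∀ i j, 0 ≤ E i j) {w : ∀ i, Fin (m i) → ℝ}
    (hw : ∀ i l, 0 ≤ w i l) (hsum : ∀ i, ∑ l, w i l = 1 ∨ ∑ l, w i l = 0) :
    memK E (fun i => vecMulVec (w i) (E i)) := by
  refine fun i => ⟨fun l j => mul_nonneg (hw i l) (hE i j), ?_⟩
  simp only [vecMulVec_apply, ← Finset.sum_mul]
  rcases hsum i with h | h <;> simp [h]

lemma closedLoop_vecMulVec (w : ∀ i, Fin (m i) → ℝ) (x : Fin n → ℝ) :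
    (A + ∑ i, B i * vecMulVec (w i) (E i)) *ᵥ x =
      A *ᵥ x + ∑ i, B i *ᵥ ((E i ⬝ᵥ x) • w i) := by
  simp [add_mulVec, sum_mulVec, ← mulVec_mulVec, vecMulVec_mulVec]

/-- Under Assumption 1 every admissible input keeps the state nonnegative. -/
lemma assumption1.next_nonneg (hA1 : assumption1 A B E) (hE : ∀ i j, 0 ≤ E i j)
    {x : Fin n → ℝ} (hx : 0 ≤ x) {u : ∀ i, Fin (m i) → ℝ} (hu : u ∈ inputSet E x) :
    0 ≤ A *ᵥ x + ∑ i, B i *ᵥ u i := by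
  intro k
  choose w hw hsum hmin using fun i => exists_dotProduct_eq_minZero (B i k)
  have h := hA1 _ (memK_vecMulVec hE hw hsum) x hx k
  rw [closedLoop_vecMulVec] at h
  refine h.trans ?_
  simp only [Pi.add_apply, Finset.sum_apply]
  refine add_le_add_right (Finset.sum_le_sum fun i _ => ?_) _
  change B i k ⬝ᵥ ((E i ⬝ᵥ x) • w i) ≤ B i k ⬝ᵥ u i
  rw [dotProduct_smul, hmin i, smul_eq_mul, mul_comm]
  exact minZero_mul_le_dotProduct _ _ (hu i).1 (hu i).2

lemma admissible.nonneg (hA1 : assumption1 A B E) (hE : ∀ i j, 0 ≤ E i j)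
    {x0 : Fin n → ℝ} (hx0 : 0 ≤ x0) {x : ℕ → Fin n → ℝ} {u : ℕ → ∀ i, Fin (m i) → ℝ}
    (h : admissible A B E x0 x u) (t : ℕ) : 0 ≤ x t := by
  induction t with
  | zero => rw [h.1]; exact hx0
  | succ t ih => rw [(h.2 t).2]; exact hA1.next_nonneg hE ih (h.2 t).1

lemma bellman_dotProduct (p x : Fin n → ℝ) :
    bellman A B s r E p ⬝ᵥ x = s ⬝ᵥ x + p ⬝ᵥ (A *ᵥ x) +
      ∑ i, minZero (fun l => r i l + ((B i)ᵀ *ᵥ p) l) * (E i ⬝ᵥ x) := by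
  have h : bellman A B s r E p = s + Aᵀ *ᵥ p +
      ∑ i, minZero (fun l => r i l + ((B i)ᵀ *ᵥ p) l) • E i := by
    ext j
    simp [bellman]
  rw [h, add_dotProduct, add_dotProduct, sum_dotProduct, mulVec_transpose,
    ← dotProduct_mulVec]
  simp [smul_dotProduct]

/-- One step of cost plus the value `p` of the next state, in terms of the vectors
`r_i + B_iᵀ p` minimized in the Bellman operator. -/
lemma stage_add_next (p x : Fin n → ℝ) (u : ∀ i, Fin (m i) → ℝ) :
    (s ⬝ᵥ x + ∑ i, r i ⬝ᵥ u i) + p ⬝ᵥ (A *ᵥ x + ∑ i, B i *ᵥ u i) =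
      s ⬝ᵥ x + p ⬝ᵥ (A *ᵥ x) + ∑ i, (fun l => r i l + ((B i)ᵀ *ᵥ p) l) ⬝ᵥ u i := by
  have h : ∀ i, (fun l => r i l + ((B i)ᵀ *ᵥ p) l) ⬝ᵥ u i =
      r i ⬝ᵥ u i + p ⬝ᵥ (B i *ᵥ u i) := by
    intro i
    change (r i + (B i)ᵀ *ᵥ p) ⬝ᵥ u i = _
    rw [add_dotProduct, mulVec_transpose, ← dotProduct_mulVec]
  simp only [h, dotProduct_add, dotProduct_sum, Finset.sum_add_distrib]
  ring

lemma bellman_dotProduct_le (p x : Fin n → ℝ) {u : ∀ i, Fin (m i) → ℝ}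
    (hu : u ∈ inputSet E x) :
    bellman A B s r E p ⬝ᵥ x ≤
      (s ⬝ᵥ x + ∑ i, r i ⬝ᵥ u i) + p ⬝ᵥ (A *ᵥ x + ∑ i, B i *ᵥ u i) := by
  rw [stage_add_next, bellman_dotProduct]
  exact add_le_add_right (Finset.sum_le_sum fun i _ =>
    minZero_mul_le_dotProduct _ _ (hu i).1 (hu i).2) _

lemma stageCost_nonneg (hs : ∀ j, 0 < s j) (hr : ∀ i l, 0 ≤ r i l) {x : Fin n → ℝ}
    (hx : 0 ≤ x) {u : ∀ i, Fin (m i) → ℝ} (hu : u ∈ inputSet E x) :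
    0 ≤ s ⬝ᵥ x + ∑ i, r i ⬝ᵥ u i :=
  add_nonneg (dotProduct_nonneg_of_nonneg (fun j => (hs j).le) hx)
    (Finset.sum_nonneg fun i _ => dotProduct_nonneg_of_nonneg (hr i) (hu i).1)

lemma dotProduct_le_sum_div_mul (hs : ∀ j, 0 < s j) {p x : Fin n → ℝ} (hp : 0 ≤ p)
    (hx : 0 ≤ x) : p ⬝ᵥ x ≤ (∑ j, p j / s j) * (s ⬝ᵥ x) := by
  rw [Finset.sum_mul]
  refine Finset.sum_le_sum fun j _ => ?_
  calc p j * x j = p j / s j * (s j * x j) := by field_simp [(hs j).ne']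
    _ ≤ p j / s j * (s ⬝ᵥ x) :=
        mul_le_mul_of_nonneg_left
          (Finset.single_le_sum (f := fun j => s j * x j)
            (fun i _ => mul_nonneg (hs i).le (hx i)) (Finset.mem_univ j))
          (div_nonneg (hp j) (hs j).le)

end Feedback

lemma ofReal_le_tsum_of_le_add {c V : ℕ → ℝ} {M : ℝ} (hc : ∀ t, 0 ≤ c t)
    (hstep : ∀ t, V t ≤ c t + V (t + 1)) (hM : ∀ t, V t ≤ M * c t) :
    ENNReal.ofReal (V 0) ≤ ∑' t, ENNReal.ofReal (c t) := by
  by_cases htop : ∑' t, ENNReal.ofReal (c t) = ⊤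
  · simp [htop]
  have hsum : Summable c := by
    simpa [ENNReal.toReal_ofReal (hc _)] using ENNReal.summable_toReal htop
  rw [← ENNReal.ofReal_tsum_of_nonneg hc hsum]
  refine ENNReal.ofReal_le_ofReal ?_
  have hpartial : ∀ N, V 0 ≤ ∑ t ∈ Finset.range N, c t + V N := by
    intro N
    induction N with
    | zero => simp
    | succ N ih => rw [Finset.sum_range_succ]; linarith [hstep N]
  have hlim : Tendsto (fun N => ∑ t ∈ Finset.range N, c t + M * c N) atTop
      (𝓝 (∑' t, c t + M * 0)) :=
    hsum.hasSum.tendsto_sum_nat.add (hsum.tendsto_atTop_zero.const_mul M)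
  rw [mul_zero, add_zero] at hlim
  exact ge_of_tendsto' hlim fun N => (hpartial N).trans (by linarith [hM N])

lemma tsum_ofReal_le_of_add_le {c V : ℕ → ℝ} (hc : ∀ t, 0 ≤ c t) (hV : ∀ t, 0 ≤ V t)
    (hstep : ∀ t, c t + V (t + 1) ≤ V t) :
    ∑' t, ENNReal.ofReal (c t) ≤ ENNReal.ofReal (V 0) := by
  have hpartial : ∀ N, ∑ t ∈ Finset.range N, c t + V N ≤ V 0 := by
    intro N
    induction N with
    | zero => simp
    | succ N ih => rw [Finset.sum_range_succ]; linarith [hstep N]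
  refine ENNReal.tsum_le_of_sum_range_le fun N => ?_
  rw [← ENNReal.ofReal_sum_of_nonneg fun t _ => hc t]
  exact ENNReal.ofReal_le_ofReal (by linarith [hpartial N, hV N])

/-- under Assumption 1, a nonnegative fixed point `p = T(p)` gives
`V(x0) = pᵀ x0` for all `x0 ≥ 0`; in particular `V(x0)` is finite and the
infimum is attained. -/
theorem stmt_4 {n : ℕ} {m : Fin n → ℕ}
    (A : Matrix (Fin n) (Fin n) ℝ) (B : ∀ i, Matrix (Fin n) (Fin (m i)) ℝ)
    (s : Fin n → ℝ) (r : ∀ i, Fin (m i) → ℝ) (E : Matrix (Fin n) (Fin n) ℝ)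
    (hs : ∀ j, 0 < s j) (hr : ∀ i l, 0 ≤ r i l)
    (hE : ∀ i j, 0 ≤ E i j) (hEinv : IsUnit E.det)
    (hA1 : assumption1 A B E)
    (p : Fin n → ℝ) (hp : 0 ≤ p) (hfix : p = bellman A B s r E p)
    (x0 : Fin n → ℝ) (hx0 : 0 ≤ x0) :
    optValue A B E s r x0 = ENNReal.ofReal (∑ j, p j * x0 j) ∧
    optValue A B E s r x0 ≠ ⊤ ∧
    ∃ x u, admissible A B E x0 x u ∧
      trajCost s r x u = optValue A B E s r x0 := by
  have hlower : ∀ x u, admissible A B E x0 x u →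
      ENNReal.ofReal (∑ j, p j * x0 j) ≤ trajCost s r x u := by
    intro x u h
    have hx := h.nonneg hA1 hE hx0
    have hM : 0 ≤ ∑ j, p j / s j := Finset.sum_nonneg fun j _ => div_nonneg (hp j) (hs j).le
    have key := ofReal_le_tsum_of_le_add (c := fun t => s ⬝ᵥ x t + ∑ i, r i ⬝ᵥ u t i)
      (V := fun t => p ⬝ᵥ x t) (M := ∑ j, p j / s j)
      (fun t => stageCost_nonneg hs hr (hx t) (h.2 t).1)
      (fun t => by
        have hle := bellman_dotProduct_le (A := A) (B := B) (s := s) (r := r) p (x t) (h.2 t).1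
        rwa [← hfix, ← (h.2 t).2] at hle)
      (fun t => (dotProduct_le_sum_div_mul hs hp (hx t)).trans
        (mul_le_mul_of_nonneg_left (le_add_of_nonneg_right (Finset.sum_nonneg fun i _ =>
          dotProduct_nonneg_of_nonneg (hr i) ((h.2 t).1 i).1)) hM))
    rw [← h.1]
    exact key
  obtain ⟨x, u, hadm, hupper⟩ : ∃ x u, admissible A B E x0 x u ∧
      trajCost s r x u ≤ ENNReal.ofReal (∑ j, p j * x0 j) := by
    choose w hw hsum hmin using fun i =>
      exists_dotProduct_eq_minZero (fun l => r i l + ((B i)ᵀ *ᵥ p) l)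
    let F : (Fin n → ℝ) → ∀ i, Fin (m i) → ℝ := fun y i => (E i ⬝ᵥ y) • w i
    let x : ℕ → Fin n → ℝ := fun t => (fun y => A *ᵥ y + ∑ i, B i *ᵥ F y i)^[t] x0
    have hsucc : ∀ t, x (t + 1) = A *ᵥ x t + ∑ i, B i *ᵥ F (x t) i := fun t =>
      Function.iterate_succ_apply' _ t x0
    have hx : ∀ t, 0 ≤ x t := by
      intro t
      induction t with
      | zero => exact hx0
      | succ t ih =>
        rw [hsucc, ← closedLoop_vecMulVec w]
        exact hA1 _ (memK_vecMulVec hE hw hsum) _ ih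
    have hF : ∀ t, F (x t) ∈ inputSet E (x t) := by
      intro t i
      have hc : 0 ≤ E i ⬝ᵥ x t := dotProduct_nonneg_of_nonneg (hE i) (hx t)
      refine ⟨fun l => mul_nonneg hc (hw i l), ?_⟩
      change ∑ l, (E i ⬝ᵥ x t) * w i l ≤ E i ⬝ᵥ x t
      rw [← Finset.mul_sum]
      rcases hsum i with h | h <;> simp [h, hc]
    refine ⟨x, fun t => F (x t), ⟨rfl, fun t => ⟨hF t, hsucc t⟩⟩, ?_⟩
    refine tsum_ofReal_le_of_add_le (c := fun t => s ⬝ᵥ x t + ∑ i, r i ⬝ᵥ F (x t) i)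
      (V := fun t => p ⬝ᵥ x t) (fun t => stageCost_nonneg hs hr (hx t) (hF t))
      (fun t => dotProduct_nonneg_of_nonneg hp (hx t)) (fun t => le_of_eq ?_)
    have hb := bellman_dotProduct (A := A) (B := B) (s := s) (r := r) (E := E) p (x t)
    rw [← hfix] at hb
    rw [hsucc, stage_add_next, hb]
    simp only [F, dotProduct_smul, hmin, smul_eq_mul, mul_comm]
  have hopt : optValue A B E s r x0 ≤ trajCost s r x u := by
    unfold optValue
    exact iInf_le_of_le x (iInf_le_of_le u (iInf_le_of_le hadm le_rfl))
  have hval : optValue A B E s r x0 = ENNReal.ofReal (∑ j, p j * x0 j) :=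
    le_antisymm (hopt.trans hupper)
      (le_iInf fun x => le_iInf fun u => le_iInf fun h => hlower x u h)
  refine ⟨hval, hval ▸ ENNReal.ofReal_ne_top, x, u, hadm, ?_⟩
  rw [hval]
  exact le_antisymm hupper (hlower x u hadm)
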